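/- Let n ≥ 6 and let Σ_n = (K_n, σ) be a doubly signed complete graph. Then the Hamiltonian circles of Σ_n realize all four elements of F as double signs if and only if the triangles of Σ_n realize at least three distinct double signs. -/

import Mathlib

/-- The Klein four-group, written additively. -/
abbrev F : Type := ZMod 2 × ZMod 2

/-- The double sign of the triangle spanned by three vertices. -/
def triSign {n : ℕ} (σ : Sym2 (Fin n) → F) (a b c : Fin n) : F :=
  σ s(a, b) + σ s(b, c) + σ s(a, c)

/-- The double sign of a walk: the sum of the labels of its edges. -/
def walkSign {n : ℕ} (σ : Sym2 (Fin n) → F) {u v : Fin n}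
    (w : (⊤ : SimpleGraph (Fin n)).Walk u v) : F :=
  (w.edges.map σ).sum

/-- The pairing of `F` with itself; the maps `dot w` with `w ≠ 0` are the nonzero characters. -/
def dot (w x : F) : ZMod 2 := w.1 * x.1 + w.2 * x.2

theorem dot_zero (w : F) : dot w 0 = 0 := by simp [dot]

theorem dot_add (w x y : F) : dot w (x + y) = dot w x + dot w y := by
  simp only [dot, Prod.fst_add, Prod.snd_add]; ring

theorem exists_dot_eq_of_no_three (S : F → Prop)
    (h : ¬ ∃ x y z, S x ∧ S y ∧ S z ∧ x ≠ y ∧ x ≠ z ∧ y ≠ z) :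
    ∃ w : F, w ≠ 0 ∧ ∃ k, ∀ x, S x → dot w x = k := by
  have key : ∀ x y : F, ∃ w : F, w ≠ 0 ∧ dot w y = dot w x := by decide
  by_cases hx : ∃ x, S x
  · obtain ⟨x, hx⟩ := hx
    by_cases hy : ∃ y, S y ∧ x ≠ y
    · obtain ⟨y, hy, hxy⟩ := hy
      obtain ⟨w, hw, hwxy⟩ := key x y
      refine ⟨w, hw, dot w x, fun z hz => ?_⟩
      by_contra hne
      exact h ⟨x, y, z, hx, hy, hz, hxy, fun e => hne (e ▸ rfl), fun e => hne (e ▸ hwxy)⟩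
    · push Not at hy
      exact ⟨(1, 0), by decide, dot (1, 0) x, fun z hz => by rw [hy z hz]⟩
  · exact ⟨(1, 0), by decide, 0, fun z hz => (hx ⟨z, hz⟩).elim⟩

theorem not_dot_eq_of_three {w x y z : F} {k : ZMod 2} (hw : w ≠ 0) (hxy : x ≠ y) (hxz : x ≠ z)
    (hyz : y ≠ z) (hx : dot w x = k) (hy : dot w y = k) (hz : dot w z = k) : False := by
  have key : ∀ w x y z : F, dot w x = dot w y ∧ dot w x = dot w z →
      w = 0 ∨ x = y ∨ x = z ∨ y = z := by decide
  have := key w x y z ⟨hx.trans hy.symm, hx.trans hz.symm⟩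
  tauto

theorem three_le_ncard_iff (S : Set F) :
    3 ≤ S.ncard ↔ ∃ x y z, x ∈ S ∧ y ∈ S ∧ z ∈ S ∧ x ≠ y ∧ x ≠ z ∧ y ≠ z :=
  Set.two_lt_ncard_iff

section Labels

variable {n : ℕ} (σ : Sym2 (Fin n) → F)

theorem triSign_swap (a b c : Fin n) : triSign σ a c b = triSign σ a b c := by
  simp only [triSign, Sym2.eq_swap (a := c) (b := b)]; abel

theorem triSign_rotate (a b c : Fin n) : triSign σ b c a = triSign σ a b c := by
  simp only [triSign, Sym2.eq_swap (a := c) (b := a), Sym2.eq_swap (a := b) (b := a)]; abel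

theorem triSign_eq_sum (r a b c : Fin n) :
    triSign σ a b c = triSign σ r a b + triSign σ r b c + triSign σ r a c := by
  have key : ∀ x y z u v w : F, x + y + z = u + x + v + (v + y + w) + (u + z + w) := by
    intro x y z u v w
    have h := fun t : F => CharTwo.add_self_eq_zero t
    linear_combination (exp := 1) -h u - h v - h w
  exact key _ _ _ _ _ _

/-- If the character `dot w` is constant on triangles, the labelling is, after applying it,
a constant plus a coboundary. -/
theorem dot_walkSign {w : F} {k : ZMod 2} (r : Fin n)
    (h : ∀ a b c, a ≠ b → a ≠ c → b ≠ c → dot w (triSign σ a b c) = k) :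
    ∃ f : Fin n → ZMod 2, ∀ (u v : Fin n) (p : (⊤ : SimpleGraph (Fin n)).Walk u v),
      dot w (walkSign σ p) = p.length * k + f u + f v := by
  have two := fun t : ZMod 2 => CharTwo.add_self_eq_zero t
  let f : Fin n → ZMod 2 := fun v => if v = r then 0 else dot w (σ s(r, v)) + k
  have hf : ∀ a b, a ≠ b → dot w (σ s(a, b)) = k + f a + f b := by
    intro a b hab
    by_cases ha : a = r
    · subst ha
      simp only [f, if_pos rfl, if_neg hab.symm]
      linear_combination -two k
    by_cases hb : b = r
    · subst hb
      simp only [f, if_pos rfl, if_neg ha, Sym2.eq_swap (a := a) (b := b)]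
      linear_combination -two k
    · have := h r a b (Ne.symm ha) (Ne.symm hb) hab
      simp only [triSign, dot_add] at this
      simp only [f, if_neg ha, if_neg hb]
      linear_combination this - two k - two (dot w (σ s(r, a))) - two (dot w (σ s(r, b)))
  refine ⟨f, fun u v p => ?_⟩
  induction p with
  | nil => simp [walkSign, dot_zero, two]
  | @cons a b c hab q ih =>
    simp only [walkSign, SimpleGraph.Walk.edges_cons, List.map_cons, List.sum_cons, dot_add,
      SimpleGraph.Walk.length_cons, Nat.cast_add, Nat.cast_one] at ih ⊢
    rw [ih, hf a b hab.ne]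
    linear_combination two (f b)

end Labels

/-- Sum of the labels `c` along consecutive entries of a list. -/
def pathSum {α : Type*} (c : α → α → F) : List α → F
  | a :: b :: l => c a b + pathSum c (b :: l)
  | _ => 0

theorem pathSum_append {α : Type*} (c : α → α → F) (l r : List α) (x : α) :
    pathSum c (l ++ x :: r) = pathSum c (l ++ [x]) + pathSum c (x :: r) := by
  induction l with
  | nil => simp [pathSum]
  | cons a l ih =>
    cases l with
    | nil => simp [pathSum]
    | cons b l =>
      simp only [List.cons_append, pathSum] at ih ⊢
      rw [ih, add_assoc]

theorem pathSum_map {α β : Type*} (c : β → β → F) (e : α → β) (l : List α) :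
    pathSum c (l.map e) = pathSum (fun i j => c (e i) (e j)) l := by
  induction l with
  | nil => rfl
  | cons a l ih =>
    cases l with
    | nil => rfl
    | cons b l =>
      simp only [List.map_cons, pathSum] at ih ⊢
      rw [ih]

/-- Switching changes the sum along a path only by a term depending on its ends. -/
theorem pathSum_switch {α : Type*} (c : α → α → F) (f : α → F) (l : List α) (a z : α) :
    pathSum (fun i j => c i j + f i + f j) (a :: (l ++ [z])) =
      pathSum c (a :: (l ++ [z])) + f a + f z := by
  have two := fun t : F => CharTwo.add_self_eq_zero t
  induction l generalizing a with
  | nil => simp [pathSum]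
  | cons b l ih =>
    simp only [List.cons_append, pathSum] at ih ⊢
    rw [ih b]
    linear_combination (exp := 1) two (f b)

section HamiltonianCycles

variable {n : ℕ} (σ : Sym2 (Fin n) → F)

/-- The labelling as a function of two vertices, with value `0` on the diagonal. -/
def edgeLabel (a b : Fin n) : F := if a = b then 0 else σ s(a, b)

theorem edgeLabel_comm (a b : Fin n) : edgeLabel σ a b = edgeLabel σ b a := by
  simp only [edgeLabel, eq_comm (a := a) (b := b), Sym2.eq_swap (a := a) (b := b)]

theorem exists_walk_of_nodup (l : List (Fin n)) (a z : Fin n) (h : (a :: (l ++ [z])).Nodup) :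
    ∃ p : (⊤ : SimpleGraph (Fin n)).Walk a z, p.support = a :: (l ++ [z]) ∧
      walkSign σ p = pathSum (edgeLabel σ) (a :: (l ++ [z])) := by
  induction l generalizing a with
  | nil =>
    have haz : a ≠ z := by simpa using h
    exact ⟨.cons haz .nil, by simp, by simp [walkSign, pathSum, edgeLabel, haz]⟩
  | cons b l ih =>
    have hab : a ≠ b := by rintro rfl; simp at h
    obtain ⟨p, hp, hs⟩ := ih b (List.nodup_cons.mp h).2
    refine ⟨.cons hab p, by simp [hp], ?_⟩
    simp only [List.cons_append, pathSum] at hs ⊢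
    rw [← hs]
    simp [walkSign, edgeLabel, hab]

theorem exists_isHamiltonianCycle_of_list (b : Fin n) (l : List (Fin n)) (a z : Fin n)
    (h : (a :: b :: (l ++ [z])).Nodup) (hmem : ∀ v, v ∈ a :: b :: (l ++ [z])) :
    ∃ w : (⊤ : SimpleGraph (Fin n)).Walk z z, w.IsHamiltonianCycle ∧
      walkSign σ w = edgeLabel σ z a + pathSum (edgeLabel σ) (a :: b :: (l ++ [z])) := by
  obtain ⟨p, hp, hs⟩ := exists_walk_of_nodup σ (b :: l) a z h
  have hza : z ≠ a := by rintro rfl; simp at h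
  have hpath : p.IsPath := by
    rw [SimpleGraph.Walk.isPath_def, hp]; exact h
  refine ⟨.cons hza p, ?_, ?_⟩
  · rw [SimpleGraph.Walk.isHamiltonianCycle_isCycle_and_isHamiltonian_tail,
      SimpleGraph.Walk.cons_isCycle_iff]
    refine ⟨⟨hpath, fun hmem => ?_⟩, ?_⟩
    · cases p with
      | nil => exact hza rfl
      | @cons _ c _ hac q =>
        have hq : q.support = b :: (l ++ [z]) := by simpa using hp
        have hcb : c = b := by
          have := q.head_support
          simp only [hq, List.head_cons] at this
          exact this.symm
        rw [SimpleGraph.Walk.edges_cons, List.mem_cons] at hmem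
        rcases hmem with hmem | hmem
        · have hzc : z = c := by
            simp only [Sym2.eq_iff] at hmem
            rcases hmem with h' | h'
            · exact absurd h'.1 hza
            · exact h'.1
          subst hcb hzc
          simp at h
        · have := q.snd_mem_support_of_mem_edges hmem
          rw [hq] at this
          exact (List.nodup_cons.mp h).1 this
    · have : p.IsHamiltonian := hpath.isHamiltonian_of_mem fun v => by rw [hp]; exact hmem v
      simpa [SimpleGraph.Walk.IsHamiltonian] using this
  · simp only [List.cons_append] at hs
    rw [← hs]
    simp [walkSign, edgeLabel, hza]

end HamiltonianCycles

/-! ### Truth tables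

A subset of the `2 ^ N` Boolean assignments of `N` variables is stored as a natural number with
`2 ^ N` binary digits; the assignment `x` gives the variable `i` the value `x.testBit i`. -/

/-- The truth table of the `i`-th of `N` variables. -/
def varTable : ℕ → ℕ → ℕ
  | 0, _ => 0
  | N + 1, i =>
    if i = N then (2 ^ 2 ^ N - 1) <<< 2 ^ N else varTable N i ||| varTable N i <<< 2 ^ N

theorem varTable_lt (N i : ℕ) : varTable N i < 2 ^ 2 ^ N := by
  have shift : ∀ N t : ℕ, t < 2 ^ 2 ^ N → t <<< 2 ^ N < 2 ^ 2 ^ (N + 1) := by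
    intro N t ht
    rw [Nat.shiftLeft_eq, pow_succ 2 N, mul_two, pow_add]
    exact Nat.mul_lt_mul_of_pos_right ht (by positivity)
  induction N with
  | zero => simp [varTable]
  | succ N ih =>
    rw [varTable]
    split_ifs
    · exact shift N _ (Nat.sub_lt (by positivity) one_pos)
    · exact Nat.or_lt_two_pow
        (ih.trans_le (Nat.pow_le_pow_right two_pos (Nat.pow_le_pow_right two_pos (by simp))))
        (shift N _ ih)

theorem testBit_varTable {N i x : ℕ} (hi : i < N) (hx : x < 2 ^ N) :
    (varTable N i).testBit x = x.testBit i := by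
  induction N generalizing x with
  | zero => omega
  | succ N ih =>
    rw [varTable]
    have hpow : 2 ^ (N + 1) = 2 ^ N + 2 ^ N := by rw [pow_succ, mul_two]
    split_ifs with h
    · subst h
      rw [Nat.testBit_shiftLeft, Nat.testBit_two_pow_sub_one]
      by_cases hx' : x < 2 ^ i
      · simp [Nat.testBit_lt_two_pow hx', hx']
      · obtain ⟨y, rfl⟩ := Nat.exists_eq_add_of_le (not_lt.mp hx')
        have hy : y < 2 ^ i := by omega
        simp [Nat.testBit_two_pow_add_eq, Nat.testBit_lt_two_pow hy, hy]
    · have hiN : i < N := by omega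
      rw [Nat.testBit_or, Nat.testBit_shiftLeft]
      by_cases hx' : x < 2 ^ N
      · simp [ih hiN hx', hx']
      · obtain ⟨y, rfl⟩ := Nat.exists_eq_add_of_le (not_lt.mp hx')
        have hy : y < 2 ^ N := by omega
        have hbig : (varTable N i).testBit (2 ^ N + y) = false :=
          Nat.testBit_lt_two_pow ((varTable_lt N i).trans_le
            (Nat.pow_le_pow_right two_pos (by omega)))
        rw [hbig, Nat.testBit_two_pow_add_gt hiN, Nat.add_sub_cancel_left, ih hiN hy]
        simp

/-- The table of the condition that always holds. -/
def onesTable : ℕ := 2 ^ 2 ^ 20 - 1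

theorem testBit_onesTable {x : ℕ} (hx : x < 2 ^ 20) : onesTable.testBit x = true := by
  rw [onesTable, Nat.testBit_two_pow_sub_one]
  exact decide_eq_true hx

def anyTable {α : Type*} (l : List α) (t : α → ℕ) : ℕ := l.foldr (fun a s => t a ||| s) 0

def allTable {α : Type*} (l : List α) (t : α → ℕ) : ℕ := l.foldr (fun a s => t a &&& s) onesTable

theorem testBit_anyTable {α : Type*} (l : List α) (t : α → ℕ) (x : ℕ) :
    (anyTable l t).testBit x = true ↔ ∃ a ∈ l, (t a).testBit x = true := by
  induction l with
  | nil => simp [anyTable]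
  | cons a l ih =>
    simp only [anyTable, List.foldr_cons, Nat.testBit_or, Bool.or_eq_true] at ih ⊢
    rw [ih]; simp

theorem testBit_allTable {α : Type*} (l : List α) (t : α → ℕ) {x : ℕ} (hx : x < 2 ^ 20) :
    (allTable l t).testBit x = true ↔ ∀ a ∈ l, (t a).testBit x = true := by
  induction l with
  | nil => simp [allTable, testBit_onesTable hx]
  | cons a l ih =>
    simp only [allTable, List.foldr_cons, Nat.testBit_and, Bool.and_eq_true] at ih ⊢
    rw [ih]; simp

/-- The pair of tables `t` takes the value `g` at the assignment `x`. -/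
def TableValue (x : ℕ) (t : ℕ × ℕ) (g : F) : Prop :=
  t.1.testBit x = decide (g.1 = 1) ∧ t.2.testBit x = decide (g.2 = 1)

theorem tableValue_zero (x : ℕ) : TableValue x (0, 0) 0 := by
  simp [TableValue]

theorem decide_add_eq_one (a b : ZMod 2) :
    decide (a + b = 1) = (decide (a = 1) ^^ decide (b = 1)) := by
  revert a b; decide

theorem TableValue.add {x : ℕ} {t u : ℕ × ℕ} {g h : F} (ht : TableValue x t g)
    (hu : TableValue x u h) : TableValue x (t.1 ^^^ u.1, t.2 ^^^ u.2) (g + h) := by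
  simp only [TableValue, Nat.testBit_xor, Prod.fst_add, Prod.snd_add, decide_add_eq_one, ht.1,
    ht.2, hu.1, hu.2, and_self]

/-- The table of `t = g`. -/
def eqTable (t : ℕ × ℕ) (g : F) : ℕ :=
  (if g.1 = 1 then t.1 else t.1 ^^^ onesTable) &&& (if g.2 = 1 then t.2 else t.2 ^^^ onesTable)

/-- The table of `t ≠ u`. -/
def neTable (t u : ℕ × ℕ) : ℕ := (t.1 ^^^ u.1) ||| (t.2 ^^^ u.2)

theorem zmod_two_eq_iff (a b : ZMod 2) : a = b ↔ (a = 1 ↔ b = 1) := by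
  revert a b; decide

theorem TableValue.eq_of_testBit {x : ℕ} {t : ℕ × ℕ} {v g : F} (hx : x < 2 ^ 20)
    (ht : TableValue x t v) (h : (eqTable t g).testBit x = true) : v = g := by
  rw [eqTable, Nat.testBit_and, Bool.and_eq_true] at h
  refine Prod.ext ((zmod_two_eq_iff _ _).mpr ?_) ((zmod_two_eq_iff _ _).mpr ?_)
  · have := h.1
    split_ifs at this with hg <;> simp_all [ht.1, testBit_onesTable hx]
  · have := h.2
    split_ifs at this with hg <;> simp_all [ht.2, testBit_onesTable hx]

theorem TableValue.testBit_neTable {x : ℕ} {t u : ℕ × ℕ} {v w : F}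
    (ht : TableValue x t v) (hu : TableValue x u w) (h : v ≠ w) :
    (neTable t u).testBit x = true := by
  by_contra hne
  apply h
  simp only [neTable, Nat.testBit_or, Nat.testBit_xor, ht.1, ht.2, hu.1, hu.2,
    Bool.or_eq_true, not_or, Bool.not_eq_true, bne_eq_false_iff_eq, decide_eq_decide] at hne
  exact Prod.ext ((zmod_two_eq_iff _ _).mpr hne.1) ((zmod_two_eq_iff _ _).mpr hne.2)

/-! ### Labelled complete graphs on six vertices

The vertices are `0, …, 5`; the labels at the vertex `0` have been switched to `0`, and the ten
remaining labels are encoded by twenty Boolean variables. -/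

/-- The position of the edge `{i, j}` in the list `12, 13, 23, 14, …, 45`. -/
def edgeIndex (i j : ℕ) : ℕ := (max i j - 1) * (max i j - 2) / 2 + (min i j - 1)

def edgeTable (i j : ℕ) : ℕ × ℕ :=
  if i = 0 ∨ j = 0 ∨ i = j then (0, 0)
  else (varTable 20 (2 * edgeIndex i j), varTable 20 (2 * edgeIndex i j + 1))

def pathTable : List ℕ → ℕ × ℕ
  | a :: b :: l => ((edgeTable a b).1 ^^^ (pathTable (b :: l)).1,
      (edgeTable a b).2 ^^^ (pathTable (b :: l)).2)
  | _ => (0, 0)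

/-- The edges among the vertices `1, 2, 3, 4`. -/
def innerPairs : List (ℕ × ℕ) := [(1, 2), (1, 3), (1, 4), (2, 3), (2, 4), (3, 4)]

def threeColorTable : ℕ :=
  anyTable innerPairs fun p => anyTable innerPairs fun q => anyTable innerPairs fun r =>
    neTable (edgeTable p.1 p.2) (edgeTable q.1 q.2) &&&
      (neTable (edgeTable p.1 p.2) (edgeTable r.1 r.2) &&&
        neTable (edgeTable q.1 q.2) (edgeTable r.1 r.2))

/-- The table of the condition that, for some `s ∈ {0, 1, 2}`, the Hamiltonian paths from `s` to `5`
realize all double signs. -/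
def coverTable : ℕ :=
  anyTable [0, 1, 2] fun s =>
    allTable [((0, 0) : F), (0, 1), (1, 0), (1, 1)] fun g =>
      anyTable (([0, 1, 2, 3, 4].erase s).permutations') fun l =>
        eqTable (pathTable (s :: (l ++ [5]))) g

set_option maxRecDepth 100000 in
theorem threeColorTable_and_coverTable : threeColorTable &&& coverTable = threeColorTable := by
  decide +kernel

theorem exists_assignment (L : ℕ → ℕ → F) (symm : ∀ i j, L i j = L j i) (hdiag : ∀ i, L i i = 0)
    (hzero : ∀ j, L 0 j = 0) :
    ∃ x < 2 ^ 20, ∀ i < 6, ∀ j < 6, TableValue x (edgeTable i j) (L i j) := by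
  let edges : List (ℕ × ℕ) :=
    [(1, 2), (1, 3), (2, 3), (1, 4), (2, 4), (3, 4), (1, 5), (2, 5), (3, 5), (4, 5)]
  let label (k : ℕ) : F := L (edges.getD k 0).1 (edges.getD k 0).2
  let bit (b : Fin 20) : Bool :=
    decide ((if b.1 % 2 = 0 then (label (b.1 / 2)).1 else (label (b.1 / 2)).2) = 1)
  have hx : Nat.ofBits bit < 2 ^ 20 := Nat.ofBits_lt_two_pow bit
  have hedge : ∀ k < 10, TableValue (Nat.ofBits bit)
      (varTable 20 (2 * k), varTable 20 (2 * k + 1)) (label k) := by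
    intro k hk
    have h₀ : 2 * k < 20 := by omega
    have h₁ : 2 * k + 1 < 20 := by omega
    refine ⟨?_, ?_⟩
    · rw [testBit_varTable h₀ hx, Nat.testBit_ofBits_lt _ _ h₀]
      simp [bit]
    · rw [testBit_varTable h₁ hx, Nat.testBit_ofBits_lt _ _ h₁]
      have : (2 * k + 1) / 2 = k := by omega
      simp [bit, this]
  have hlt : ∀ i j, i < j → j < 6 → TableValue (Nat.ofBits bit) (edgeTable i j) (L i j) := by
    intro i j hij hj
    obtain rfl | hi := Nat.eq_zero_or_pos i
    · simp [edgeTable, hzero, tableValue_zero]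
    · have hk : edgeIndex i j < 10 ∧ edges.getD (edgeIndex i j) 0 = (i, j) := by
        interval_cases j <;> interval_cases i <;> decide
      have := hedge _ hk.1
      simp only [label, hk.2] at this
      rwa [edgeTable, if_neg (by omega)]
  refine ⟨Nat.ofBits bit, hx, fun i hi j hj => ?_⟩
  rcases lt_trichotomy i j with h | rfl | h
  · exact hlt i j h hj
  · simp [edgeTable, hdiag, tableValue_zero]
  · have hcomm : edgeTable i j = edgeTable j i := by
      simp only [edgeTable, edgeIndex, max_comm i j, min_comm i j]
      congr 1
      simp only [eq_iff_iff]; omega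
    rw [hcomm, symm]
    exact hlt j i h hi

theorem tableValue_pathTable {x : ℕ} {L : ℕ → ℕ → F}
    (h : ∀ i < 6, ∀ j < 6, TableValue x (edgeTable i j) (L i j)) (l : List ℕ)
    (hl : ∀ i ∈ l, i < 6) :
    TableValue x (pathTable l) (pathSum L l) := by
  induction l with
  | nil => exact tableValue_zero x
  | cons a l ih =>
    cases l with
    | nil => exact tableValue_zero x
    | cons b l =>
      exact (h a (hl a (by simp)) b (hl b (by simp))).add
        (ih fun i hi => hl i (List.mem_cons_of_mem a hi))

theorem exists_paths_covering (L : ℕ → ℕ → F) (symm : ∀ i j, L i j = L j i)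
    (hdiag : ∀ i, L i i = 0) (hzero : ∀ j, L 0 j = 0)
    (hthree : ∃ p ∈ innerPairs, ∃ q ∈ innerPairs, ∃ r ∈ innerPairs,
      L p.1 p.2 ≠ L q.1 q.2 ∧ L p.1 p.2 ≠ L r.1 r.2 ∧ L q.1 q.2 ≠ L r.1 r.2) :
    ∃ s, ∀ g, ∃ l, (s :: (l ++ [5])).Perm [0, 1, 2, 3, 4, 5] ∧
      pathSum L (s :: (l ++ [5])) = g := by
  obtain ⟨x, hx, hL⟩ := exists_assignment L symm hdiag hzero
  have hthreeBit : threeColorTable.testBit x = true := by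
    have hin : ∀ p ∈ innerPairs, p.1 < 6 ∧ p.2 < 6 := by decide
    have hne : ∀ p ∈ innerPairs, ∀ q ∈ innerPairs, L p.1 p.2 ≠ L q.1 q.2 →
        (neTable (edgeTable p.1 p.2) (edgeTable q.1 q.2)).testBit x = true :=
      fun p hp q hq h => (hL _ (hin p hp).1 _ (hin p hp).2).testBit_neTable
        (hL _ (hin q hq).1 _ (hin q hq).2) h
    obtain ⟨p, hp, q, hq, r, hr, hpq, hpr, hqr⟩ := hthree
    simp only [threeColorTable, testBit_anyTable, Nat.testBit_and, Bool.and_eq_true]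
    exact ⟨p, hp, q, hq, r, hr, hne p hp q hq hpq, hne p hp r hr hpr, hne q hq r hr hqr⟩
  have hcover : coverTable.testBit x = true := by
    rw [← threeColorTable_and_coverTable, Nat.testBit_and, Bool.and_eq_true] at hthreeBit
    exact hthreeBit.2
  simp only [coverTable, testBit_anyTable, testBit_allTable _ _ hx,
    List.mem_permutations'] at hcover
  obtain ⟨s, hs, h⟩ := hcover
  refine ⟨s, fun g => ?_⟩
  obtain ⟨l, hl, hbit⟩ := h g (by revert g; decide)
  have hmem : s ∈ [0, 1, 2, 3, 4] :=
    (by decide : [0, 1, 2] ⊆ [0, 1, 2, 3, 4]) hs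
  have hperm : (s :: (l ++ [5])).Perm [0, 1, 2, 3, 4, 5] :=
    ((hl.cons s).trans (List.perm_cons_erase hmem).symm).append_right [5]
  refine ⟨l, hperm, (tableValue_pathTable hL _ fun i hi => ?_).eq_of_testBit hx hbit⟩
  exact (by decide : ∀ i ∈ [0, 1, 2, 3, 4, 5], i < 6) i (hperm.subset hi)

theorem exists_four_vertices {α : Type*} (c : α → α → F) (symm : ∀ a b, c a b = c b a)
    (hex : ∀ u v w : α, ∃ x, x ≠ u ∧ x ≠ v ∧ x ≠ w)
    {u₁ v₁ u₂ v₂ u₃ v₃ : α} (h₁ : u₁ ≠ v₁) (h₂ : u₂ ≠ v₂) (h₃ : u₃ ≠ v₃)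
    (h₁₂ : c u₁ v₁ ≠ c u₂ v₂) (h₁₃ : c u₁ v₁ ≠ c u₃ v₃) (h₂₃ : c u₂ v₂ ≠ c u₃ v₃) :
    ∃ p q s t : α, [p, q, s, t].Nodup ∧
      ∃ x ∈ [c p q, c p s, c p t, c q s, c q t, c s t],
      ∃ y ∈ [c p q, c p s, c p t, c q s, c q t, c s t],
      ∃ z ∈ [c p q, c p s, c p t, c q s, c q t, c s t], x ≠ y ∧ x ≠ z ∧ y ≠ z := by
  by_contra hno
  have hfour : ∀ p q s t : α, p ≠ q → p ≠ s → p ≠ t → q ≠ s → q ≠ t → s ≠ t →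
      ∀ x ∈ [c p q, c p s, c p t, c q s, c q t, c s t],
      ∀ y ∈ [c p q, c p s, c p t, c q s, c q t, c s t],
      ∀ z ∈ [c p q, c p s, c p t, c q s, c q t, c s t], x ≠ y → z = x ∨ z = y := by
    intro p q s t hpq hps hpt hqs hqt hst x hx y hy z hz hxy
    by_contra hz'
    exact hno ⟨p, q, s, t, by simp [hpq, hps, hpt, hqs, hqt, hst], x, hx, y, hy, z, hz, hxy,
      fun e => hz' (.inl e.symm), fun e => hz' (.inr e.symm)⟩
  clear hno
  obtain ⟨u, v, w, huv, huw, hvw, hne⟩ :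
      ∃ u v w, u ≠ v ∧ u ≠ w ∧ v ≠ w ∧ c u v ≠ c v w := by
    by_contra hadj
    have hshare : ∀ u v w, v ≠ u → v ≠ w → c v u = c v w := by
      intro u v w h h'
      by_cases huw : u = w
      · rw [huw]
      · by_contra hc
        exact hadj ⟨u, v, w, h.symm, huw, h', by rwa [symm u v]⟩
    apply h₁₂
    by_cases h : u₁ = v₂
    · subst h
      rw [hshare v₁ u₁ u₂ h₁ h₂.symm, symm]
    · rw [hshare v₁ u₁ v₂ h₁ h, symm, hshare u₁ v₂ u₂ (Ne.symm h) h₂.symm, symm]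
  have hmeet : ∀ y x, y ∈ [u, v, w] → x ≠ y → c x y = c u v ∨ c x y = c v w := by
    have hout : ∀ y x, y ∈ [u, v, w] → x ∉ [u, v, w] → c x y = c u v ∨ c x y = c v w := by
      intro y x hy hx
      simp only [List.mem_cons, List.not_mem_nil, or_false, not_or] at hy hx
      refine hfour u v w x huv huw (Ne.symm hx.1) hvw (Ne.symm hx.2.1) (Ne.symm hx.2.2)
        _ (by simp) _ (by simp) _ ?_ hne
      rw [symm x y]
      rcases hy with rfl | rfl | rfl <;> simp
    obtain ⟨x', hx'u, hx'v, hx'w⟩ := hex u v w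
    have huw' : c u w = c u v ∨ c u w = c v w :=
      hfour u v w x' huv huw hx'u.symm hvw hx'v.symm hx'w.symm
        _ (by simp) _ (by simp) _ (by simp) hne
    intro y x hy hxy
    by_cases hx : x ∈ [u, v, w]
    · simp only [List.mem_cons, List.not_mem_nil, or_false] at hx hy
      rcases hx with rfl | rfl | rfl <;> rcases hy with rfl | rfl | rfl <;>
        first
        | exact absurd rfl hxy
        | exact .inl rfl
        | exact .inr rfl
        | exact .inl (symm _ _)
        | exact .inr (symm _ _)
        | exact huw'
        | (rw [symm]; exact huw')
    · exact hout y x hy hx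
  have hall : ∀ x y, x ≠ y → c x y = c u v ∨ c x y = c v w := by
    intro x y hxy
    by_cases hy : y ∈ [u, v, w]
    · exact hmeet y x hy hxy
    by_cases hx : x ∈ [u, v, w]
    · rw [symm]; exact hmeet x y hx hxy.symm
    have hxv : x ≠ v := by rintro rfl; simp at hx
    simp only [List.mem_cons, List.not_mem_nil, or_false, not_or] at hx hy
    rcases hmeet v x (by simp) hxv with h | h
    · have := hfour x y v w hxy hx.2.1 hx.2.2 hy.2.1 hy.2.2 hvw
        (c x v) (by simp) (c v w) (by simp) (c x y) (by simp) (by rwa [h])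
      rwa [h] at this
    · have := hfour x y v u hxy hx.2.1 hx.1 hy.2.1 hy.1 huv.symm
        (c v u) (by simp) (c x v) (by simp) (c x y) (by simp) (by rwa [h, symm])
      rwa [h, symm v u] at this
  rcases hall _ _ h₁ with h₁ | h₁ <;> rcases hall _ _ h₂ with h₂ | h₂ <;>
    rcases hall _ _ h₃ with h₃ | h₃ <;>
    first
    | exact h₁₂ (h₁.trans h₂.symm)
    | exact h₁₃ (h₁.trans h₃.symm)
    | exact h₂₃ (h₂.trans h₃.symm)

section Triangles

variable {n : ℕ} (σ : Sym2 (Fin n) → F)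

/-- Triangles through a fixed vertex already realize three signs if all triangles do. -/
theorem exists_three_triSign_at (r : Fin n)
    (h : ∃ x y z : F, (∃ a b c, a ≠ b ∧ a ≠ c ∧ b ≠ c ∧ triSign σ a b c = x) ∧
      (∃ a b c, a ≠ b ∧ a ≠ c ∧ b ≠ c ∧ triSign σ a b c = y) ∧
      (∃ a b c, a ≠ b ∧ a ≠ c ∧ b ≠ c ∧ triSign σ a b c = z) ∧ x ≠ y ∧ x ≠ z ∧ y ≠ z) :
    ∃ x y z : F, (∃ u v : {v // v ≠ r}, u ≠ v ∧ triSign σ r u v = x) ∧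
      (∃ u v : {v // v ≠ r}, u ≠ v ∧ triSign σ r u v = y) ∧
      (∃ u v : {v // v ≠ r}, u ≠ v ∧ triSign σ r u v = z) ∧ x ≠ y ∧ x ≠ z ∧ y ≠ z := by
  by_contra hno
  obtain ⟨w, hw, k, hk⟩ := exists_dot_eq_of_no_three
    (fun x => ∃ u v : {v // v ≠ r}, u ≠ v ∧ triSign σ r u v = x) hno
  have hr : ∀ a b, a ≠ r → b ≠ r → a ≠ b → dot w (triSign σ r a b) = k := fun a b ha hb hab =>
    hk _ ⟨⟨a, ha⟩, ⟨b, hb⟩, fun e => hab (congrArg Subtype.val e), rfl⟩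
  have hall : ∀ x, (∃ a b c, a ≠ b ∧ a ≠ c ∧ b ≠ c ∧ triSign σ a b c = x) → dot w x = k := by
    rintro x ⟨a, b, c, hab, hac, hbc, rfl⟩
    by_cases ha : a = r
    · subst ha; exact hr b c hab.symm hac.symm hbc
    by_cases hb : b = r
    · subst hb; rw [← triSign_rotate]; exact hr c a hbc.symm hab hac.symm
    by_cases hc : c = r
    · subst hc; rw [← triSign_rotate, ← triSign_rotate]; exact hr a b hac hbc hab
    · rw [triSign_eq_sum σ r, dot_add, dot_add, hr a b ha hb hab, hr b c hb hc hbc,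
        hr a c ha hc hac, CharTwo.add_self_eq_zero, zero_add]
  obtain ⟨x, y, z, hx, hy, hz, hxy, hxz, hyz⟩ := h
  exact not_dot_eq_of_three hw hxy hxz hyz (hall x hx) (hall y hy) (hall z hz)

theorem exists_not_mem_of_length_lt (l : List (Fin n)) (h : l.length < n) : ∃ x, x ∉ l := by
  by_contra hall
  push Not at hall
  have := (Finset.card_le_card (fun x _ => List.mem_toFinset.mpr (hall x) :
    (Finset.univ : Finset (Fin n)) ⊆ l.toFinset)).trans l.toFinset_card_le
  simp at this
  omega

/-- Six vertices, two of which are joined by Hamiltonian paths of all double signs. -/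
theorem exists_six_vertices (hn : 6 ≤ n)
    (h : ∃ x y z : F, (∃ a b c, a ≠ b ∧ a ≠ c ∧ b ≠ c ∧ triSign σ a b c = x) ∧
      (∃ a b c, a ≠ b ∧ a ≠ c ∧ b ≠ c ∧ triSign σ a b c = y) ∧
      (∃ a b c, a ≠ b ∧ a ≠ c ∧ b ≠ c ∧ triSign σ a b c = z) ∧ x ≠ y ∧ x ≠ z ∧ y ≠ z) :
    ∃ (V : List (Fin n)) (a z : Fin n), V.length = 6 ∧ V.Nodup ∧
      ∀ g, ∃ l, (a :: (l ++ [z])).Perm V ∧ pathSum (edgeLabel σ) (a :: (l ++ [z])) = g := by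
  have two := fun t : F => CharTwo.add_self_eq_zero t
  let r : Fin n := ⟨0, by omega⟩
  obtain ⟨_, _, _, ⟨u₁, v₁, h₁, rfl⟩, ⟨u₂, v₂, h₂, rfl⟩, ⟨u₃, v₃, h₃, rfl⟩, h₁₂, h₁₃, h₂₃⟩ :=
    exists_three_triSign_at σ r h
  obtain ⟨p, q, s, t, hnodup, hthree⟩ := exists_four_vertices
    (fun a b : {v // v ≠ r} => triSign σ r a b) (fun a b => (triSign_swap σ r a b).symm)
    (fun u v w => by
      obtain ⟨x, hx⟩ := exists_not_mem_of_length_lt [r, u.1, v.1, w.1] (by simp; omega)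
      simp only [List.mem_cons, List.not_mem_nil, or_false, not_or] at hx
      exact ⟨⟨x, hx.1⟩, by simpa [Subtype.ext_iff] using hx.2⟩) h₁ h₂ h₃ h₁₂ h₁₃ h₂₃
  obtain ⟨f, hf⟩ := exists_not_mem_of_length_lt [r, p.1, q.1, s.1, t.1] (by simp; omega)
  let V : List (Fin n) := [r, p, q, s, t, f]
  have hV : V.Nodup := by
    simp only [V, List.nodup_cons, List.mem_cons, List.not_mem_nil, or_false, not_or,
      Subtype.ext_iff, not_false_eq_true, List.nodup_nil, and_true] at hnodup hf ⊢
    obtain ⟨⟨hpq, hps, hpt⟩, ⟨hqs, hqt⟩, hst⟩ := hnodup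
    obtain ⟨hfr, hfp, hfq, hfs, hft⟩ := hf
    exact ⟨⟨Ne.symm p.2, Ne.symm q.2, Ne.symm s.2, Ne.symm t.2, Ne.symm hfr⟩,
      ⟨hpq, hps, hpt, Ne.symm hfp⟩, ⟨hqs, hqt, Ne.symm hfq⟩, ⟨hst, Ne.symm hfs⟩, Ne.symm hft⟩
  let e (i : ℕ) : Fin n := V.getD i r
  let c (i j : ℕ) : F := edgeLabel σ (e i) (e j)
  let L (i j : ℕ) : F := c i j + c 0 i + c 0 j
  have hL : ∀ i j, e i ≠ e j → e i ≠ r → e j ≠ r → L i j = triSign σ r (e i) (e j) := by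
    intro i j hij hi hj
    have he : e 0 = r := rfl
    simp only [L, c, he, edgeLabel, if_neg hij, if_neg hi.symm, if_neg hj.symm, triSign]
    abel
  have hinner : innerPairs.map (fun p => L p.1 p.2) =
      [triSign σ r p q, triSign σ r p s, triSign σ r p t, triSign σ r q s, triSign σ r q t,
        triSign σ r s t] := by
    simp only [List.nodup_cons, List.mem_cons, List.not_mem_nil, or_false, not_or,
      Subtype.ext_iff, not_false_eq_true, List.nodup_nil, and_true] at hnodup
    obtain ⟨⟨hpq, hps, hpt⟩, ⟨hqs, hqt⟩, hst⟩ := hnodup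
    simp only [innerPairs, List.map_cons, List.map_nil]
    rw [hL 1 2 hpq p.2 q.2, hL 1 3 hps p.2 s.2, hL 1 4 hpt p.2 t.2, hL 2 3 hqs q.2 s.2,
      hL 2 4 hqt q.2 t.2, hL 3 4 hst s.2 t.2]
    rfl
  obtain ⟨i, hi⟩ := exists_paths_covering L
    (fun i j => by simp only [L, c, edgeLabel_comm σ (e i) (e j)]; abel)
    (fun i => by simp [L, c, edgeLabel, two])
    (fun j => by
      have : c 0 0 = 0 := by simp [c, edgeLabel]
      simp [L, this, two])
    (by
      rw [← hinner] at hthree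
      simpa only [List.mem_map, exists_exists_and_eq_and] using hthree)
  refine ⟨V, e i, e 5, rfl, hV, fun g => ?_⟩
  obtain ⟨l, hperm, hsum⟩ := hi (g + c 0 i + c 0 5)
  refine ⟨l.map e, ?_, ?_⟩
  · simpa [e, V] using hperm.map e
  · have hswitch := pathSum_switch c (c 0) l i 5
    have hmap := pathSum_map (edgeLabel σ) e (i :: (l ++ [5]))
    simp only [List.map_cons, List.map_append, List.map_nil] at hmap
    rw [hmap]
    have hLsum : pathSum L (i :: (l ++ [5])) = pathSum c (i :: (l ++ [5])) + c 0 i + c 0 5 :=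
      hswitch
    rw [hsum] at hLsum
    exact (add_right_cancel (add_right_cancel hLsum)).symm

end Triangles

theorem exists_isHamiltonianCycle_of_paths {n : ℕ} (σ : Sym2 (Fin n) → F) {V : List (Fin n)}
    {a z : Fin n} (hlen : V.length = 6) (hV : V.Nodup)
    (hpaths : ∀ g, ∃ l, (a :: (l ++ [z])).Perm V ∧
      pathSum (edgeLabel σ) (a :: (l ++ [z])) = g) (g : F) :
    ∃ (v : Fin n) (w : (⊤ : SimpleGraph (Fin n)).Walk v v),
      w.IsHamiltonianCycle ∧ walkSign σ w = g := by
  let rest : List (Fin n) := (Finset.univ.filter (· ∉ V)).toList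
  have hrest : ∀ v, v ∈ rest ↔ v ∉ V := by simp [rest]
  obtain ⟨m, y, hm⟩ : ∃ m y, z :: rest = m ++ [y] :=
    ⟨_, _, (List.dropLast_append_getLast (List.cons_ne_nil z rest)).symm⟩
  obtain ⟨l, hperm, hsum⟩ := hpaths (g + edgeLabel σ y a + pathSum (edgeLabel σ) (z :: rest))
  obtain ⟨b, l, rfl⟩ : ∃ b l', l = b :: l' := by
    cases l with
    | nil => have := hperm.length_eq; simp [hlen] at this
    | cons b l => exact ⟨b, l, rfl⟩
  have hcycle : a :: b :: (l ++ m ++ [y]) = (a :: (b :: l ++ [z])) ++ rest := by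
    simp [← hm]
  have hnodup : (a :: b :: (l ++ m ++ [y])).Nodup := by
    rw [hcycle]
    exact List.Nodup.append (hperm.nodup_iff.mpr hV) (Finset.nodup_toList _)
      fun v hv hv' => (hrest v).mp hv' (hperm.subset hv)
  obtain ⟨w, hw, hsign⟩ := exists_isHamiltonianCycle_of_list σ b (l ++ m) a y hnodup fun v => by
    rw [hcycle, List.mem_append, hrest, hperm.mem_iff]; exact em _
  refine ⟨y, w, hw, ?_⟩
  have hsplit := pathSum_append (edgeLabel σ) (a :: b :: l) rest z
  have hcycle' : a :: b :: (l ++ m ++ [y]) = (a :: b :: l) ++ z :: rest := by simp [hm]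
  have hsum' : pathSum (edgeLabel σ) ((a :: b :: l) ++ [z]) = _ := hsum
  rw [hsign, hcycle', hsplit, hsum']
  have two := fun t : F => CharTwo.add_self_eq_zero t
  linear_combination (exp := 1) two (edgeLabel σ y a) + two (pathSum (edgeLabel σ) (z :: rest))

theorem stmt16 (n : ℕ) (hn : 6 ≤ n) (σ : Sym2 (Fin n) → F) :
    (∀ g : F, ∃ (v : Fin n) (w : (⊤ : SimpleGraph (Fin n)).Walk v v),
      w.IsHamiltonianCycle ∧ walkSign σ w = g) ↔
    3 ≤ Set.ncard {g : F | ∃ a b c : Fin n,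
      a ≠ b ∧ a ≠ c ∧ b ≠ c ∧ triSign σ a b c = g} := by
  rw [three_le_ncard_iff]
  constructor
  · intro h
    by_contra hno
    obtain ⟨w, hw, k, hk⟩ := exists_dot_eq_of_no_three _ hno
    obtain ⟨f, hf⟩ := dot_walkSign σ (w := w) (k := k) ⟨0, by omega⟩
      fun a b c hab hac hbc => hk _ ⟨a, b, c, hab, hac, hbc, rfl⟩
    have hconst : ∀ g : F, dot w g = n * k := by
      intro g
      obtain ⟨v, p, hp, rfl⟩ := h g
      rw [hf, hp.length_eq, Fintype.card_fin, add_assoc, CharTwo.add_self_eq_zero, add_zero]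
    exact not_dot_eq_of_three (x := (0, 0)) (y := (0, 1)) (z := (1, 0)) hw (by decide)
      (by decide) (by decide) (hconst _) (hconst _) (hconst _)
  · intro h
    obtain ⟨V, a, z, hlen, hV, hpaths⟩ := exists_six_vertices σ hn h
    exact exists_isHamiltonianCycle_of_paths σ hlen hV hpaths
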